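/- arXiv:2504.19663 — 4 statements merged into one kernel-verified Lean document; each statement's English description precedes it below -/
import Mathlib

section
/- Let T ∈ (0,∞). Suppose u is a Schwartz class solution of the Boussinesq equation u_tt = u_xx + (u²)_xx + u_xxxx on [0,∞)×[0,T] with existence time T, initial data u₀, u₁ ∈ 𝒮(ℝ₊) and boundary values ũ₀, ũ₁, ũ₂, ũ₃ ∈ C^∞([0,T]). Define v(x,t) := ∫_{+∞}^{x} u_t(x′,t) dx′, v₀(x) := ∫_{+∞}^{x} u₁(x′) dx′, and ṽ₀(t) := ∫_{+∞}^{0} u₁(x′) dx′ + ∫_0^t (ũ₁(t′) + 2ũ₀(t′)ũ₁(t′) + ũ₃(t′)) dt′. Then v₀ ∈ 𝒮(ℝ₊), ṽ₀ ∈ C^∞([0,T]), and (u,v) is a Schwartz class solution of the Boussinesq system v_t = u_x + (u²)_x + u_{xxx}, u_t = v_x on [0,∞)×[0,T] with existence time T, initial data u₀, v₀ and boundary values ũ₀, ũ₁, ũ₂, ṽ₀. -/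
noncomputable section

open MeasureTheory Set

/-- 𝒮(ℝ₊): smooth functions on [0,∞) decaying, with all derivatives, faster than
any power of x as x → +∞. -/
def SchwartzHalfW (f : ℝ → ℝ) : Prop :=
  ContDiffOn ℝ (⊤ : ℕ∞) f (Ici 0) ∧
  ∀ n N : ℕ, ∃ C : ℝ, ∀ x : ℝ, 0 ≤ x →
    (1 + x) ^ N * |iteratedDerivWithin n f (Ici 0) x| ≤ C

/-- C^∞([0,T]). -/
def SmoothOnIcc (T : ℝ) (f : ℝ → ℝ) : Prop := ContDiffOn ℝ (⊤ : ℕ∞) f (Icc 0 T)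

/-- n-th partial derivative in x (within [0,∞)) of a function u = u(x,t). -/
def dxn (n : ℕ) (u : ℝ → ℝ → ℝ) (t x : ℝ) : ℝ :=
  iteratedDerivWithin n (fun y => u y t) (Ici 0) x

/-- Partial derivative in t (within [0,T]) of a function u = u(x,t). -/
def dt1 (T : ℝ) (u : ℝ → ℝ → ℝ) (x t : ℝ) : ℝ :=
  derivWithin (fun s => u x s) (Icc 0 T) t

/-- Schwartz class solution of the Boussinesq system v_t = u_x + (u²)_x + u_xxx,
u_t = v_x on [0,∞)×[0,T], with the given initial and boundary values and rapid decay. -/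
def IsSolSystem (T : ℝ) (u v : ℝ → ℝ → ℝ) (u0 v0 tu0 tu1 tu2 tv0 : ℝ → ℝ) : Prop :=
  ContDiffOn ℝ (⊤ : ℕ∞) (fun p : ℝ × ℝ => u p.1 p.2) (Ici 0 ×ˢ Icc 0 T) ∧
  ContDiffOn ℝ (⊤ : ℕ∞) (fun p : ℝ × ℝ => v p.1 p.2) (Ici 0 ×ˢ Icc 0 T) ∧
  (∀ x ∈ Ici (0:ℝ), ∀ t ∈ Icc (0:ℝ) T,
    dt1 T v x t = dxn 1 u t x + dxn 1 (fun y s => u y s ^ 2) t x + dxn 3 u t x ∧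
    dt1 T u x t = dxn 1 v t x) ∧
  (∀ x ∈ Ici (0:ℝ), u x 0 = u0 x ∧ v x 0 = v0 x) ∧
  (∀ t ∈ Icc (0:ℝ) T,
    u 0 t = tu0 t ∧ dxn 1 u t 0 = tu1 t ∧ dxn 2 u t 0 = tu2 t ∧ v 0 t = tv0 t) ∧
  (∀ N : ℕ, 1 ≤ N → ∃ C : ℝ, ∀ x ∈ Ici (0:ℝ), ∀ t ∈ Icc (0:ℝ) T,
    (∑ i ∈ Finset.range (N + 1), (1 + x) ^ N * (|dxn i u t x| + |dxn i v t x|)) ≤ C)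

/-- Schwartz class solution of the Boussinesq equation u_tt = u_xx + (u²)_xx + u_xxxx
on [0,∞)×[0,T], with the given initial and boundary values and rapid decay. -/
def IsSolEq (T : ℝ) (u : ℝ → ℝ → ℝ) (u0 u1 tu0 tu1 tu2 tu3 : ℝ → ℝ) : Prop :=
  ContDiffOn ℝ (⊤ : ℕ∞) (fun p : ℝ × ℝ => u p.1 p.2) (Ici 0 ×ˢ Icc 0 T) ∧
  (∀ x ∈ Ici (0:ℝ), ∀ t ∈ Icc (0:ℝ) T,
    iteratedDerivWithin 2 (fun s => u x s) (Icc 0 T) t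
      = dxn 2 u t x + dxn 2 (fun y s => u y s ^ 2) t x + dxn 4 u t x) ∧
  (∀ x ∈ Ici (0:ℝ), u x 0 = u0 x ∧ dt1 T u x 0 = u1 x) ∧
  (∀ t ∈ Icc (0:ℝ) T,
    u 0 t = tu0 t ∧ dxn 1 u t 0 = tu1 t ∧ dxn 2 u t 0 = tu2 t ∧ dxn 3 u t 0 = tu3 t) ∧
  (∀ N : ℕ, 1 ≤ N → ∃ C : ℝ, ∀ x ∈ Ici (0:ℝ), ∀ t ∈ Icc (0:ℝ) T,
    (∑ i ∈ Finset.range (N + 1), (1 + x) ^ N * |dxn i u t x|) ≤ C)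

section Auxiliary

open Filter Topology
open scoped ContDiff

/-- The derivative of `f` within `s` in the direction `w`. -/
def dirDerivWithin (s : Set (ℝ × ℝ)) (w : ℝ × ℝ) (f : ℝ × ℝ → ℝ) (p : ℝ × ℝ) : ℝ :=
  fderivWithin ℝ f s p w

section DirDeriv

variable {s : Set (ℝ × ℝ)} {f g : ℝ × ℝ → ℝ} {w : ℝ × ℝ}

lemma contDiffOn_dirDerivWithin (hs : UniqueDiffOn ℝ s) (hf : ContDiffOn ℝ ∞ f s) (w : ℝ × ℝ) :
    ContDiffOn ℝ ∞ (dirDerivWithin s w f) s :=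
  (hf.fderivWithin hs (m := ∞) (by simp)).clm_apply contDiffOn_const

lemma contDiffOn_iterate_dirDerivWithin (hs : UniqueDiffOn ℝ s) (hf : ContDiffOn ℝ ∞ f s)
    (w : ℝ × ℝ) (n : ℕ) : ContDiffOn ℝ ∞ ((dirDerivWithin s w)^[n] f) s := by
  induction n with
  | zero => exact hf
  | succ n ih =>
    rw [Function.iterate_succ_apply']
    exact contDiffOn_dirDerivWithin hs ih w

lemma dirDerivWithin_congr (h : EqOn f g s) (w : ℝ × ℝ) :
    EqOn (dirDerivWithin s w f) (dirDerivWithin s w g) s := fun p hp => by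
  rw [dirDerivWithin, dirDerivWithin, fderivWithin_congr h (h hp)]

lemma iterate_dirDerivWithin_congr (h : EqOn f g s) (w : ℝ × ℝ) (n : ℕ) :
    EqOn ((dirDerivWithin s w)^[n] f) ((dirDerivWithin s w)^[n] g) s := by
  induction n with
  | zero => exact h
  | succ n ih =>
    rw [Function.iterate_succ_apply', Function.iterate_succ_apply']
    exact dirDerivWithin_congr ih w

lemma dirDerivWithin_add (hs : UniqueDiffOn ℝ s) (hf : ContDiffOn ℝ ∞ f s)
    (hg : ContDiffOn ℝ ∞ g s) (w : ℝ × ℝ) :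
    EqOn (dirDerivWithin s w (f + g)) (dirDerivWithin s w f + dirDerivWithin s w g) s :=
  fun p hp => by
  simp only [dirDerivWithin, Pi.add_apply]
  rw [fderivWithin_add (hs p hp) (hf.differentiableOn (by simp) p hp)
    (hg.differentiableOn (by simp) p hp)]
  rfl

lemma dirDerivWithin_mul (hs : UniqueDiffOn ℝ s) (hf : ContDiffOn ℝ ∞ f s)
    (hg : ContDiffOn ℝ ∞ g s) (w : ℝ × ℝ) :
    EqOn (dirDerivWithin s w (f * g))
      (dirDerivWithin s w f * g + f * dirDerivWithin s w g) s :=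
  fun p hp => by
  simp only [dirDerivWithin, Pi.add_apply, Pi.mul_apply]
  rw [fderivWithin_mul (hs p hp) (hf.differentiableOn (by simp) p hp)
    (hg.differentiableOn (by simp) p hp)]
  simp
  ring

lemma iterate_dirDerivWithin_add (hs : UniqueDiffOn ℝ s) (hf : ContDiffOn ℝ ∞ f s)
    (hg : ContDiffOn ℝ ∞ g s) (w : ℝ × ℝ) (n : ℕ) :
    EqOn ((dirDerivWithin s w)^[n] (f + g))
      ((dirDerivWithin s w)^[n] f + (dirDerivWithin s w)^[n] g) s := by
  induction n with
  | zero => exact fun _ _ => rfl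
  | succ n ih =>
    simp only [Function.iterate_succ_apply']
    exact (dirDerivWithin_congr ih w).trans
      (dirDerivWithin_add hs (contDiffOn_iterate_dirDerivWithin hs hf w n)
        (contDiffOn_iterate_dirDerivWithin hs hg w n) w)

lemma dirDerivWithin_comm (hs : UniqueDiffOn ℝ s) (hs' : s ⊆ closure (interior s))
    (hf : ContDiffOn ℝ ∞ f s) (w z : ℝ × ℝ) :
    EqOn (dirDerivWithin s w (dirDerivWithin s z f))
      (dirDerivWithin s z (dirDerivWithin s w f)) s := by
  intro p hp
  have key : ∀ w z : ℝ × ℝ, dirDerivWithin s w (dirDerivWithin s z f) p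
      = fderivWithin ℝ (fderivWithin ℝ f s) s p w z := by
    intro w z
    have hd : DifferentiableWithinAt ℝ (fderivWithin ℝ f s) s p :=
      (hf.fderivWithin hs (m := ∞) (by simp)).differentiableOn (by simp) p hp
    have : HasFDerivWithinAt (fun q => fderivWithin ℝ f s q z)
        ((fderivWithin ℝ (fderivWithin ℝ f s) s p).flip z) s p := by
      have := hd.hasFDerivWithinAt.clm_apply (hasFDerivWithinAt_const z p s)
      simpa using this
    change fderivWithin ℝ (fun q => fderivWithin ℝ f s q z) s p w = _
    rw [this.fderivWithin (hs p hp)]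
    rfl
  rw [key, key]
  exact ((hf p hp).isSymmSndFDerivWithinAt
    (by simpa using WithTop.coe_le_coe.2 (le_top : (2 : ℕ∞) ≤ ⊤)) hs (hs' hp) hp).eq w z

lemma iterate_dirDerivWithin_comm (hs : UniqueDiffOn ℝ s) (hs' : s ⊆ closure (interior s))
    (hf : ContDiffOn ℝ ∞ f s) (w z : ℝ × ℝ) (n : ℕ) :
    EqOn (dirDerivWithin s w ((dirDerivWithin s z)^[n] f))
      ((dirDerivWithin s z)^[n] (dirDerivWithin s w f)) s := by
  induction n with
  | zero => exact fun _ _ => rfl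
  | succ n ih =>
    simp only [Function.iterate_succ_apply']
    exact (dirDerivWithin_comm hs hs' (contDiffOn_iterate_dirDerivWithin hs hf z n) w z).trans
      (dirDerivWithin_congr ih z)

lemma contDiffOn_of_hasFDerivWithinAt {a b : ℝ × ℝ → ℝ} (hs : UniqueDiffOn ℝ s)
    (ha : ContDiffOn ℝ ∞ a s) (hb : ContDiffOn ℝ ∞ b s)
    (hf : ∀ p ∈ s, HasFDerivWithinAt f (a p • ContinuousLinearMap.fst ℝ ℝ ℝ +
      b p • ContinuousLinearMap.snd ℝ ℝ ℝ) s p) : ContDiffOn ℝ ∞ f s := by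
  rw [contDiffOn_infty_iff_fderivWithin hs]
  refine ⟨fun p hp => (hf p hp).differentiableWithinAt, ?_⟩
  exact ((ha.smul contDiffOn_const).add (hb.smul contDiffOn_const)).congr
    fun p hp => (hf p hp).fderivWithin (hs p hp)

end DirDeriv

section Product

variable {I J : Set ℝ} {f : ℝ × ℝ → ℝ}

lemma hasDerivWithinAt_fst (hf : ContDiffOn ℝ ∞ f (I ×ˢ J)) {x t : ℝ} (hx : x ∈ I) (ht : t ∈ J) :
    HasDerivWithinAt (fun y => f (y, t)) (dirDerivWithin (I ×ˢ J) (1, 0) f (x, t)) I x := by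
  have h1 := (hf.differentiableOn (by simp) (x, t) ⟨hx, ht⟩).hasFDerivWithinAt
  have h2 : HasDerivWithinAt (fun y : ℝ => (y, t)) ((1 : ℝ), (0 : ℝ)) I x :=
    (hasDerivWithinAt_id x I).prodMk (hasDerivWithinAt_const x I t)
  exact h1.comp_hasDerivWithinAt x h2 (fun y hy => mk_mem_prod hy ht)

lemma hasDerivWithinAt_snd (hf : ContDiffOn ℝ ∞ f (I ×ˢ J)) {x t : ℝ} (hx : x ∈ I) (ht : t ∈ J) :
    HasDerivWithinAt (fun r => f (x, r)) (dirDerivWithin (I ×ˢ J) (0, 1) f (x, t)) J t := by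
  have h1 := (hf.differentiableOn (by simp) (x, t) ⟨hx, ht⟩).hasFDerivWithinAt
  have h2 : HasDerivWithinAt (fun r : ℝ => (x, r)) ((0 : ℝ), (1 : ℝ)) J t :=
    (hasDerivWithinAt_const t J x).prodMk (hasDerivWithinAt_id t J)
  exact h1.comp_hasDerivWithinAt t h2 (fun y hy => mk_mem_prod hx hy)

lemma iteratedDerivWithin_fst (hI : UniqueDiffOn ℝ I) (hJ : UniqueDiffOn ℝ J)
    (hf : ContDiffOn ℝ ∞ f (I ×ˢ J)) {x t : ℝ} (hx : x ∈ I) (ht : t ∈ J) (n : ℕ) :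
    iteratedDerivWithin n (fun y => f (y, t)) I x =
      (dirDerivWithin (I ×ˢ J) (1, 0))^[n] f (x, t) := by
  induction n generalizing f with
  | zero => simp
  | succ n ih =>
    rw [iteratedDerivWithin_succ', Function.iterate_succ_apply,
      ← ih (contDiffOn_dirDerivWithin (hI.prod hJ) hf _)]
    exact iteratedDerivWithin_congr
      (fun y hy => (hasDerivWithinAt_fst hf hy ht).derivWithin (hI y hy)) hx

lemma iteratedDerivWithin_snd (hI : UniqueDiffOn ℝ I) (hJ : UniqueDiffOn ℝ J)
    (hf : ContDiffOn ℝ ∞ f (I ×ˢ J)) {x t : ℝ} (hx : x ∈ I) (ht : t ∈ J) (n : ℕ) :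
    iteratedDerivWithin n (fun r => f (x, r)) J t =
      (dirDerivWithin (I ×ˢ J) (0, 1))^[n] f (x, t) := by
  induction n generalizing f with
  | zero => simp
  | succ n ih =>
    rw [iteratedDerivWithin_succ', Function.iterate_succ_apply,
      ← ih (contDiffOn_dirDerivWithin (hI.prod hJ) hf _)]
    exact iteratedDerivWithin_congr
      (fun y hy => (hasDerivWithinAt_snd hf hx hy).derivWithin (hJ y hy)) ht

/-- On a product of two sets, the first one convex, a function with partial derivatives of which
the first one is continuous is Fréchet differentiable. -/
lemma hasFDerivWithinAt_of_partial (hI : Convex ℝ I) {a : ℝ × ℝ → ℝ} {b x t : ℝ} (hx : x ∈ I)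
    (ha : ContinuousWithinAt a (I ×ˢ J) (x, t))
    (h1 : ∀ y ∈ I, ∀ r ∈ J, HasDerivWithinAt (fun z => f (z, r)) (a (y, r)) I y)
    (h2 : HasDerivWithinAt (fun r => f (x, r)) b J t) :
    HasFDerivWithinAt f (a (x, t) • ContinuousLinearMap.fst ℝ ℝ ℝ +
      b • ContinuousLinearMap.snd ℝ ℝ ℝ) (I ×ˢ J) (x, t) := by
  rw [hasFDerivWithinAt_iff_isLittleO, Asymptotics.isLittleO_iff]
  intro c hc
  have h2' := h2
  rw [hasDerivWithinAt_iff_isLittleO, Asymptotics.isLittleO_iff] at h2'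
  have h2'' := h2' (half_pos hc)
  obtain ⟨d₂, hd₂, H2⟩ := Metric.mem_nhdsWithin_iff.1 h2''
  obtain ⟨d₁, hd₁, H1⟩ := Metric.continuousWithinAt_iff.1 ha (c / 2) (half_pos hc)
  refine Metric.mem_nhdsWithin_iff.2 ⟨min d₁ d₂, lt_min hd₁ hd₂, ?_⟩
  rintro ⟨y, r⟩ ⟨hd, hy, hr⟩
  simp only at hy hr
  have hdy : dist y x < min d₁ d₂ := lt_of_le_of_lt (le_max_left _ _) hd
  have hdr : dist r t < min d₁ d₂ := lt_of_le_of_lt (le_max_right _ _) hd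
  have B := H2 ⟨lt_of_lt_of_le hdr (min_le_right _ _), hr⟩
  have A : ‖(f (y, r) - a (x, t) * y) - (f (x, r) - a (x, t) * x)‖ ≤ c / 2 * ‖y - x‖ := by
    refine Convex.norm_image_sub_le_of_norm_hasDerivWithin_le
      (f := fun z => f (z, r) - a (x, t) * z) (f' := fun z => a (z, r) - a (x, t))
      (s := I ∩ Metric.ball x d₁) ?_ ?_ (hI.inter (convex_ball _ _))
      ⟨hx, Metric.mem_ball_self hd₁⟩ ⟨hy, lt_of_lt_of_le hdy (min_le_left _ _)⟩
    · rintro z ⟨hz, -⟩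
      have := ((h1 z hz r hr).sub ((hasDerivWithinAt_id z I).const_mul (a (x, t))))
      simp only [mul_one] at this
      exact this.mono inter_subset_left
    · rintro z ⟨hz, hzb⟩
      refine (H1 (x := (z, r)) ⟨hz, hr⟩ ?_).le
      exact max_lt hzb (lt_of_lt_of_le hdr (min_le_left _ _))
  have e : f (y, r) - f (x, t) - (a (x, t) • ContinuousLinearMap.fst ℝ ℝ ℝ +
      b • ContinuousLinearMap.snd ℝ ℝ ℝ) ((y, r) - (x, t)) =
      ((f (y, r) - a (x, t) * y) - (f (x, r) - a (x, t) * x)) +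
        (f (x, r) - f (x, t) - (r - t) • b) := by
    simp
    ring
  have n1 : ‖y - x‖ ≤ ‖(y, r) - (x, t)‖ := norm_fst_le ((y, r) - (x, t))
  have n2 : ‖r - t‖ ≤ ‖(y, r) - (x, t)‖ := norm_snd_le ((y, r) - (x, t))
  rw [mem_ofPred_eq, e]
  rw [mem_ofPred_eq] at B
  refine (norm_add_le _ _).trans ?_
  nlinarith [A, B, n1, n2, hc]

end Product

section OneVariable

lemma hasDerivWithinAt_integral_Icc {f : ℝ → ℝ} {T : ℝ} (hT : 0 ≤ T)
    (hf : ContinuousOn f (Icc 0 T)) {t : ℝ} (ht : t ∈ Icc 0 T) :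
    HasDerivWithinAt (fun r => ∫ x in (0 : ℝ)..r, f x) (f t) (Icc 0 T) t := by
  have hg : Continuous (IccExtend hT ((Icc 0 T).domRestrict f)) :=
    (continuousOn_iff_continuous_domRestrict.1 hf).Icc_extend'
  have key : ∀ x ∈ Icc 0 T, IccExtend hT ((Icc 0 T).domRestrict f) x = f x := fun x hx => by
    rw [IccExtend_of_mem hT _ hx]; rfl
  have h := (intervalIntegral.integral_hasDerivAt_right (hg.intervalIntegrable 0 t)
    (hg.stronglyMeasurableAtFilter _ _) hg.continuousAt).hasDerivWithinAt (s := Icc 0 T)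
  rw [key t ht] at h
  have e : ∀ r ∈ Icc 0 T, ∫ x in (0 : ℝ)..r, f x =
      ∫ x in (0 : ℝ)..r, IccExtend hT ((Icc 0 T).domRestrict f) x := by
    intro r hr
    refine intervalIntegral.integral_congr fun x hx => ?_
    rw [uIcc_of_le hr.1] at hx
    exact (key x ⟨hx.1, hx.2.trans hr.2⟩).symm
  exact h.congr e (e t ht)

lemma hasDerivWithinAt_neg_integral_Ioi {f : ℝ → ℝ} (hf : ContinuousOn f (Ici 0))
    (hi : IntegrableOn f (Ioi 0)) {x : ℝ} (hx : 0 ≤ x) :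
    HasDerivWithinAt (fun y => -∫ z in Ioi y, f z) (f x) (Ici 0) x := by
  have hg : Continuous (fun y => f (max 0 y)) :=
    hf.comp_continuous (by fun_prop) (fun y => le_max_left 0 y)
  have h := ((intervalIntegral.integral_hasDerivAt_right (hg.intervalIntegrable 0 x)
    (hg.stronglyMeasurableAtFilter _ _) hg.continuousAt).hasDerivWithinAt (s := Ici 0)).sub_const
      (∫ z in Ioi 0, f z)
  rw [max_eq_right hx] at h
  have e : ∀ y ∈ Ici (0 : ℝ), -∫ z in Ioi y, f z =
      (∫ z in (0 : ℝ)..y, f (max 0 z)) - ∫ z in Ioi 0, f z := by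
    intro y hy
    have h1 : ∫ z in (0 : ℝ)..y, f (max 0 z) = ∫ z in (0 : ℝ)..y, f z := by
      refine intervalIntegral.integral_congr fun z hz => ?_
      rw [uIcc_of_le hy] at hz
      simp only [max_eq_right hz.1]
    rw [h1, ← intervalIntegral.integral_Ioi_sub_Ioi hi hy]
    ring
  exact h.congr e (e x hx)

variable {f : ℝ → ℝ} {C : ℝ}

lemma abs_le_mul_inv_one_add_sq {y z : ℝ} (hy : 0 ≤ y) (hC : (1 + y) ^ 2 * |z| ≤ C) :
    |z| ≤ C * (1 + y ^ 2)⁻¹ := by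
  rw [← div_eq_mul_inv, le_div_iff₀ (by positivity)]
  nlinarith [mul_nonneg hy (abs_nonneg z)]

lemma integrableOn_Ioi_of_decay (hf : ContinuousOn f (Ici 0))
    (hC : ∀ y, 0 ≤ y → (1 + y) ^ 2 * |f y| ≤ C) {x : ℝ} (hx : 0 ≤ x) :
    IntegrableOn f (Ioi x) := by
  refine Integrable.mono' (g := fun y => C * (1 + y ^ 2)⁻¹)
    ((integrable_inv_one_add_sq.const_mul C).integrableOn)
    ((hf.mono fun y hy => hx.trans (le_of_lt hy)).aestronglyMeasurable measurableSet_Ioi) ?_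
  filter_upwards [ae_restrict_mem measurableSet_Ioi] with y hy
  have hy0 : 0 ≤ y := hx.trans (le_of_lt hy)
  exact abs_le_mul_inv_one_add_sq hy0 (hC y hy0)

lemma decay_integral_Ioi {N : ℕ} (hC : ∀ y, 0 ≤ y → (1 + y) ^ (N + 2) * |f y| ≤ C) {x : ℝ}
    (hx : 0 ≤ x) : (1 + x) ^ N * |∫ y in Ioi x, f y| ≤ C * Real.pi := by
  have hC0 : 0 ≤ C := (by positivity : (0 : ℝ) ≤ (1 + 0) ^ (N + 2) * |f 0|).trans (hC 0 le_rfl)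
  have hi : Integrable (fun y : ℝ => C * (1 + y ^ 2)⁻¹) := integrable_inv_one_add_sq.const_mul C
  have e : (1 + x) ^ N * |∫ y in Ioi x, f y| = ‖∫ y in Ioi x, (1 + x) ^ N * f y‖ := by
    rw [integral_const_mul, norm_mul, Real.norm_eq_abs, Real.norm_eq_abs,
      abs_of_nonneg (by positivity : (0 : ℝ) ≤ (1 + x) ^ N)]
  rw [e]
  calc ‖∫ y in Ioi x, (1 + x) ^ N * f y‖ ≤ ∫ y in Ioi x, C * (1 + y ^ 2)⁻¹ := by
        refine norm_integral_le_of_norm_le hi.integrableOn ?_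
        filter_upwards [ae_restrict_mem measurableSet_Ioi] with y hy
        have hy0 : 0 ≤ y := hx.trans (le_of_lt hy)
        refine abs_le_mul_inv_one_add_sq hy0 (le_trans ?_ (hC y hy0))
        rw [abs_mul, abs_of_nonneg (by positivity : (0 : ℝ) ≤ (1 + x) ^ N), pow_add, mul_left_comm,
          mul_assoc]
        have : x ≤ y := le_of_lt hy
        gcongr
    _ ≤ ∫ y : ℝ, C * (1 + y ^ 2)⁻¹ :=
        setIntegral_le_integral hi (Eventually.of_forall fun y => by positivity)
    _ = C * Real.pi := by rw [integral_const_mul, integral_univ_inv_one_add_sq]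

end OneVariable

section Strip

/-- The closed half-strip `[0, ∞) × [0, T]`. -/
abbrev halfStrip (T : ℝ) : Set (ℝ × ℝ) := Ici 0 ×ˢ Icc 0 T

/-- The partial derivative in the first variable within the half-strip. -/
abbrev stripDx (T : ℝ) : (ℝ × ℝ → ℝ) → ℝ × ℝ → ℝ := dirDerivWithin (halfStrip T) (1, 0)

/-- The partial derivative in the second variable within the half-strip. -/
abbrev stripDt (T : ℝ) : (ℝ × ℝ → ℝ) → ℝ × ℝ → ℝ := dirDerivWithin (halfStrip T) (0, 1)

/-- Decay in the first variable faster than any power, uniformly in the second variable. -/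
def RapidDecay (T : ℝ) (f : ℝ × ℝ → ℝ) : Prop :=
  ∀ N : ℕ, ∃ C : ℝ, ∀ x, 0 ≤ x → ∀ t ∈ Icc 0 T, (1 + x) ^ N * |f (x, t)| ≤ C

/-- Smooth functions on the half-strip which decay rapidly together with all their derivatives in
the first variable. -/
def StripSchwartz (T : ℝ) (f : ℝ × ℝ → ℝ) : Prop :=
  ContDiffOn ℝ ∞ f (halfStrip T) ∧ ∀ n : ℕ, RapidDecay T ((stripDx T)^[n] f)

variable {T : ℝ} {f g : ℝ × ℝ → ℝ}

lemma uniqueDiffOn_halfStrip (hT : 0 < T) : UniqueDiffOn ℝ (halfStrip T) :=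
  (uniqueDiffOn_Ici 0).prod (uniqueDiffOn_Icc hT)

lemma halfStrip_subset_closure_interior (hT : 0 < T) :
    halfStrip T ⊆ closure (interior (halfStrip T)) := by
  rw [interior_prod_eq, interior_Ici, interior_Icc, closure_prod_eq, closure_Ioi,
    closure_Ioo hT.ne]

lemma RapidDecay.congr (hf : RapidDecay T f) (h : EqOn g f (halfStrip T)) : RapidDecay T g :=
  fun N => (hf N).imp fun _ hC x hx t ht => by
    rw [h (mk_mem_prod hx ht)]
    exact hC x hx t ht

lemma RapidDecay.add (hf : RapidDecay T f) (hg : RapidDecay T g) : RapidDecay T (f + g) := by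
  intro N
  obtain ⟨C, hC⟩ := hf N
  obtain ⟨D, hD⟩ := hg N
  refine ⟨C + D, fun x hx t ht => ?_⟩
  calc (1 + x) ^ N * |f (x, t) + g (x, t)|
      ≤ (1 + x) ^ N * (|f (x, t)| + |g (x, t)|) := by gcongr; exact abs_add_le _ _
    _ ≤ C + D := by linarith [hC x hx t ht, hD x hx t ht]

lemma RapidDecay.mul (hf : RapidDecay T f) (hg : RapidDecay T g) : RapidDecay T (f * g) := by
  intro N
  obtain ⟨C, hC⟩ := hf N
  obtain ⟨D, hD⟩ := hg 0
  refine ⟨C * D, fun x hx t ht => ?_⟩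
  have hC' := hC x hx t ht
  have hD' := hD x hx t ht
  rw [pow_zero, one_mul] at hD'
  rw [Pi.mul_apply, abs_mul, ← mul_assoc]
  exact mul_le_mul hC' hD' (abs_nonneg _) (le_trans (by positivity) hC')

lemma StripSchwartz.congr (hf : StripSchwartz T f) (h : EqOn g f (halfStrip T)) :
    StripSchwartz T g :=
  ⟨hf.1.congr h, fun n => (hf.2 n).congr (iterate_dirDerivWithin_congr h _ n)⟩

lemma StripSchwartz.rapidDecay (hf : StripSchwartz T f) : RapidDecay T f := hf.2 0

lemma StripSchwartz.stripDx (hT : 0 < T) (hf : StripSchwartz T f) :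
    StripSchwartz T (stripDx T f) :=
  ⟨contDiffOn_dirDerivWithin (uniqueDiffOn_halfStrip hT) hf.1 _, fun n => hf.2 (n + 1)⟩

lemma StripSchwartz.iterate_stripDx (hT : 0 < T) (hf : StripSchwartz T f) (n : ℕ) :
    StripSchwartz T ((_root_.stripDx T)^[n] f) := by
  induction n with
  | zero => exact hf
  | succ n ih =>
    rw [Function.iterate_succ_apply']
    exact ih.stripDx hT

lemma StripSchwartz.add (hT : 0 < T) (hf : StripSchwartz T f) (hg : StripSchwartz T g) :
    StripSchwartz T (f + g) :=
  ⟨hf.1.add hg.1, fun n => ((hf.2 n).add (hg.2 n)).congr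
    (iterate_dirDerivWithin_add (uniqueDiffOn_halfStrip hT) hf.1 hg.1 _ n)⟩

lemma StripSchwartz.mul (hT : 0 < T) (hf : StripSchwartz T f) (hg : StripSchwartz T g) :
    StripSchwartz T (f * g) := by
  refine ⟨hf.1.mul hg.1, fun n => ?_⟩
  induction n generalizing f g with
  | zero => exact hf.rapidDecay.mul hg.rapidDecay
  | succ n ih =>
    have hU := uniqueDiffOn_halfStrip hT
    have hf' := hf.stripDx hT
    have hg' := hg.stripDx hT
    rw [Function.iterate_succ_apply]
    exact ((ih hf' hg).add (ih hf hg')).congr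
      ((iterate_dirDerivWithin_congr (dirDerivWithin_mul hU hf.1 hg.1 _) _ n).trans
        (iterate_dirDerivWithin_add hU (hf'.1.mul hg.1) (hf.1.mul hg'.1) _ n))

lemma RapidDecay.of_stripDt (hf : ContDiffOn ℝ ∞ f (halfStrip T))
    (h0 : ∀ N : ℕ, ∃ C : ℝ, ∀ x, 0 ≤ x → (1 + x) ^ N * |f (x, 0)| ≤ C)
    (h : RapidDecay T (stripDt T f)) : RapidDecay T f := by
  intro N
  obtain ⟨C, hC⟩ := h0 N
  obtain ⟨D, hD⟩ := h N
  refine ⟨D * T + C, fun x hx t ht => ?_⟩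
  have hp : (0 : ℝ) < (1 + x) ^ N := by positivity
  have h0T : (0 : ℝ) ∈ Icc 0 T := ⟨le_rfl, ht.1.trans ht.2⟩
  have hD0 : 0 ≤ D := le_trans (by positivity) (hD x hx t ht)
  have key : ‖f (x, t) - f (x, 0)‖ ≤ D / (1 + x) ^ N * ‖t - 0‖ := by
    refine Convex.norm_image_sub_le_of_norm_hasDerivWithin_le (f := fun r => f (x, r))
      (fun r hr => hasDerivWithinAt_snd hf hx hr) (fun r hr => ?_) (convex_Icc 0 T) h0T ht
    rw [le_div_iff₀ hp, mul_comm]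
    exact hD x hx r hr
  rw [sub_zero, Real.norm_eq_abs, Real.norm_eq_abs, abs_of_nonneg ht.1, div_mul_eq_mul_div,
    le_div_iff₀ hp, mul_comm] at key
  have h3 : |f (x, t)| ≤ |f (x, t) - f (x, 0)| + |f (x, 0)| := by
    simpa using abs_add_le (f (x, t) - f (x, 0)) (f (x, 0))
  calc (1 + x) ^ N * |f (x, t)|
      ≤ (1 + x) ^ N * (|f (x, t) - f (x, 0)| + |f (x, 0)|) := by gcongr
    _ ≤ D * t + C := by linarith [hC x hx]
    _ ≤ D * T + C := by gcongr; exact ht.2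

/-- Rapid decay of `∂ₜf` follows from that of `∂ₜ²f` and of the initial values. -/
lemma StripSchwartz.of_stripDt (hT : 0 < T) (hf : ContDiffOn ℝ ∞ f (halfStrip T))
    (h0 : ∀ n N : ℕ, ∃ C : ℝ, ∀ x, 0 ≤ x → (1 + x) ^ N * |(_root_.stripDx T)^[n] f (x, 0)| ≤ C)
    (h : StripSchwartz T (stripDt T f)) : StripSchwartz T f := by
  have hU := uniqueDiffOn_halfStrip hT
  exact ⟨hf, fun n => RapidDecay.of_stripDt (contDiffOn_iterate_dirDerivWithin hU hf _ n) (h0 n)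
    ((h.2 n).congr (iterate_dirDerivWithin_comm hU (halfStrip_subset_closure_interior hT) hf _ _ n))⟩

lemma continuousOn_slice_fst {t : ℝ} (hf : ContDiffOn ℝ ∞ f (halfStrip T)) (ht : t ∈ Icc 0 T) :
    ContinuousOn (fun x => f (x, t)) (Ici 0) :=
  hf.continuousOn.comp (by fun_prop) fun _ hx => mk_mem_prod hx ht

lemma continuousOn_slice_snd {x : ℝ} (hf : ContDiffOn ℝ ∞ f (halfStrip T)) (hx : 0 ≤ x) :
    ContinuousOn (fun t => f (x, t)) (Icc 0 T) :=
  hf.continuousOn.comp (by fun_prop) fun _ ht => mk_mem_prod hx ht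

lemma RapidDecay.integrableOn_Ioi (hd : RapidDecay T f) (hf : ContDiffOn ℝ ∞ f (halfStrip T))
    {x t : ℝ} (hx : 0 ≤ x) (ht : t ∈ Icc 0 T) : IntegrableOn (fun y => f (y, t)) (Ioi x) := by
  obtain ⟨C, hC⟩ := hd 2
  exact integrableOn_Ioi_of_decay (continuousOn_slice_fst hf ht) (fun y hy => hC y hy t ht) hx

lemma RapidDecay.tendsto_zero (hd : RapidDecay T f) {t : ℝ} (ht : t ∈ Icc 0 T) :
    Tendsto (fun x => f (x, t)) atTop (𝓝 0) := by
  obtain ⟨C, hC⟩ := hd 1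
  have h : Tendsto (fun x : ℝ => C / (1 + x)) atTop (𝓝 0) :=
    tendsto_const_nhds.div_atTop (tendsto_atTop_add_const_left _ _ tendsto_id)
  refine squeeze_zero_norm' ?_ h
  filter_upwards [eventually_ge_atTop 0] with x hx
  rw [Real.norm_eq_abs, le_div_iff₀ (by positivity), mul_comm]
  simpa using hC x hx t ht

lemma StripSchwartz.integral_stripDx (hT : 0 < T) (hf : StripSchwartz T f) {x t : ℝ}
    (hx : 0 ≤ x) (ht : t ∈ Icc 0 T) : ∫ y in Ioi x, _root_.stripDx T f (y, t) = -f (x, t) := by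
  have hf' := hf.stripDx hT
  rw [integral_Ioi_of_hasDerivAt_of_tendsto (f := fun y => f (y, t)) (m := 0) ?_ ?_
    (hf'.rapidDecay.integrableOn_Ioi hf'.1 hx ht) (hf.rapidDecay.tendsto_zero ht), zero_sub]
  · exact (continuousOn_slice_fst hf.1 ht x hx).mono (Ici_subset_Ici.2 hx)
  · intro y hy
    have hy0 : 0 < y := lt_of_le_of_lt hx hy
    exact (hasDerivWithinAt_fst hf.1 hy0.le ht).hasDerivAt (Ici_mem_nhds hy0)

lemma integral_stripDt (hT : 0 < T) (hf : ContDiffOn ℝ ∞ f (halfStrip T)) {x t : ℝ}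
    (hx : 0 ≤ x) (ht : t ∈ Icc 0 T) :
    ∫ r in (0 : ℝ)..t, stripDt T f (x, r) = f (x, t) - f (x, 0) := by
  have hs : Icc 0 t ⊆ Icc 0 T := Icc_subset_Icc_right ht.2
  refine intervalIntegral.integral_eq_sub_of_hasDerivAt_of_le (f := fun r => f (x, r)) ht.1
    ((continuousOn_slice_snd hf hx).mono hs) (fun r hr => ?_) ?_
  · exact (hasDerivWithinAt_snd hf hx (hs (Ioo_subset_Icc_self hr))).hasDerivAt
      (Icc_mem_nhds hr.1 (hr.2.trans_le ht.2))
  · refine ContinuousOn.intervalIntegrable ?_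
    rw [uIcc_of_le ht.1]
    exact (continuousOn_slice_snd
      (contDiffOn_dirDerivWithin (uniqueDiffOn_halfStrip hT) hf _) hx).mono hs

lemma RapidDecay.integrable_prod (hd : RapidDecay T f) (hf : ContDiffOn ℝ ∞ f (halfStrip T))
    {x t : ℝ} (hx : 0 ≤ x) (ht : t ∈ Icc 0 T) :
    Integrable (Function.uncurry fun r y => f (y, r))
      ((volume.restrict (uIoc 0 t)).prod (volume.restrict (Ioi x))) := by
  obtain ⟨C, hC⟩ := hd 2
  rw [uIoc_of_le ht.1]
  have hb : Integrable (fun q : ℝ × ℝ => C * (1 + q.2 ^ 2)⁻¹)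
      ((volume.restrict (Ioc 0 t)).prod (volume.restrict (Ioi x))) :=
    Integrable.mul_prod (f := fun _ => C) (g := fun y => (1 + y ^ 2)⁻¹)
      (integrable_const C) integrable_inv_one_add_sq.integrableOn
  refine hb.mono' ?_ ?_
  · rw [Measure.prod_restrict]
    refine ContinuousOn.aestronglyMeasurable ?_ (measurableSet_Ioc.prod measurableSet_Ioi)
    refine hf.continuousOn.comp (f := fun q : ℝ × ℝ => (q.2, q.1)) (by fun_prop) ?_
    rintro ⟨r, y⟩ ⟨hr, hy⟩
    exact mk_mem_prod (hx.trans (le_of_lt hy)) ⟨hr.1.le, hr.2.trans ht.2⟩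
  · rw [Measure.prod_restrict]
    filter_upwards [ae_restrict_mem (measurableSet_Ioc.prod measurableSet_Ioi)]
    rintro ⟨r, y⟩ ⟨hr, hy⟩
    have hy0 : 0 ≤ y := hx.trans (le_of_lt hy)
    exact abs_le_mul_inv_one_add_sq hy0 (hC y hy0 r ⟨hr.1.le, hr.2.trans ht.2⟩)

/-- The primitive of `g` in the first variable which vanishes at infinity. -/
def primitiveAtTop (g : ℝ × ℝ → ℝ) (p : ℝ × ℝ) : ℝ := -∫ y in Ioi p.1, g (y, p.2)

lemma StripSchwartz.schwartzHalfW (hT : 0 < T) (hf : StripSchwartz T f) {t : ℝ}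
    (ht : t ∈ Icc 0 T) : SchwartzHalfW (fun x => f (x, t)) := by
  refine ⟨hf.1.comp (f := fun x => (x, t)) (by fun_prop) fun _ hx => mk_mem_prod hx ht,
    fun n N => ?_⟩
  obtain ⟨C, hC⟩ := hf.2 n N
  refine ⟨C, fun x hx => ?_⟩
  rw [iteratedDerivWithin_fst (uniqueDiffOn_Ici 0) (uniqueDiffOn_Icc hT) hf.1 hx ht]
  exact hC x hx t ht

lemma SchwartzHalfW.congr {f g : ℝ → ℝ} (hf : SchwartzHalfW f) (h : EqOn g f (Ici 0)) :
    SchwartzHalfW g :=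
  ⟨hf.1.congr h, fun n N => (hf.2 n N).imp fun _ hC x hx => by
    rw [iteratedDerivWithin_congr h hx]
    exact hC x hx⟩

section Partial

variable {u : ℝ → ℝ → ℝ}

lemma dxn_eq_iterate_stripDx (hT : 0 < T) (hf : ContDiffOn ℝ ∞ f (halfStrip T))
    (h : EqOn (fun p => u p.1 p.2) f (halfStrip T)) {x t : ℝ} (hx : x ∈ Ici 0)
    (ht : t ∈ Icc 0 T) (n : ℕ) : dxn n u t x = (stripDx T)^[n] f (x, t) := by
  rw [← iteratedDerivWithin_fst (uniqueDiffOn_Ici 0) (uniqueDiffOn_Icc hT) hf hx ht]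
  exact iteratedDerivWithin_congr (fun y hy => h (mk_mem_prod hy ht)) hx

lemma dt1_eq_stripDt (hT : 0 < T) (hf : ContDiffOn ℝ ∞ f (halfStrip T))
    (h : EqOn (fun p => u p.1 p.2) f (halfStrip T)) {x t : ℝ} (hx : x ∈ Ici 0)
    (ht : t ∈ Icc 0 T) : dt1 T u x t = stripDt T f (x, t) := by
  exact (derivWithin_congr (fun r hr => h (mk_mem_prod hx hr)) (h (mk_mem_prod hx ht))).trans
    ((hasDerivWithinAt_snd hf hx ht).derivWithin (uniqueDiffOn_Icc hT t ht))

end Partial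

variable (hT : 0 < T) (hg : StripSchwartz T g) (hf : StripSchwartz T f)
  (h : EqOn (stripDt T g) (stripDx T f) (halfStrip T))
include hT hg hf h

lemma primitiveAtTop_eq_add_integral {x t : ℝ} (hx : 0 ≤ x) (ht : t ∈ Icc 0 T) :
    primitiveAtTop g (x, t) = primitiveAtTop g (x, 0) + ∫ r in (0 : ℝ)..t, f (x, r) := by
  have h0T : (0 : ℝ) ∈ Icc 0 T := ⟨le_rfl, hT.le⟩
  have hs : uIcc 0 t ⊆ Icc 0 T := by
    rw [uIcc_of_le ht.1]
    exact Icc_subset_Icc_right ht.2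
  have hf' := hf.stripDx hT
  have key : ∫ r in (0 : ℝ)..t, f (x, r) = -∫ y in Ioi x, (g (y, t) - g (y, 0)) := by
    calc ∫ r in (0 : ℝ)..t, f (x, r)
        = ∫ r in (0 : ℝ)..t, -∫ y in Ioi x, stripDx T f (y, r) :=
          intervalIntegral.integral_congr fun r hr => by
            simp only [hf.integral_stripDx hT hx (hs hr), neg_neg]
      _ = -∫ y in Ioi x, ∫ r in (0 : ℝ)..t, stripDx T f (y, r) := by
          rw [intervalIntegral.integral_neg, intervalIntegral_integral_swap
            (hf'.rapidDecay.integrable_prod hf'.1 hx ht)]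
      _ = -∫ y in Ioi x, (g (y, t) - g (y, 0)) := by
          congr 1
          refine setIntegral_congr_fun measurableSet_Ioi fun y hy => ?_
          have hy0 : 0 ≤ y := hx.trans (le_of_lt hy)
          rw [← integral_stripDt hT hg.1 hy0 ht]
          exact intervalIntegral.integral_congr fun r hr => (h (mk_mem_prod hy0 (hs hr))).symm
  rw [key, integral_sub (hg.rapidDecay.integrableOn_Ioi hg.1 hx ht)
    (hg.rapidDecay.integrableOn_Ioi hg.1 hx h0T)]
  simp only [primitiveAtTop]
  ring

lemma hasFDerivWithinAt_primitiveAtTop {p : ℝ × ℝ} (hp : p ∈ halfStrip T) :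
    HasFDerivWithinAt (primitiveAtTop g) (g p • ContinuousLinearMap.fst ℝ ℝ ℝ +
      f p • ContinuousLinearMap.snd ℝ ℝ ℝ) (halfStrip T) p := by
  obtain ⟨x, t⟩ := p
  obtain ⟨hx, ht⟩ := hp
  refine hasFDerivWithinAt_of_partial (convex_Ici 0) hx (hg.1.continuousOn _ ⟨hx, ht⟩) ?_ ?_
  · intro y hy r hr
    exact hasDerivWithinAt_neg_integral_Ioi (continuousOn_slice_fst hg.1 hr)
      (hg.rapidDecay.integrableOn_Ioi hg.1 le_rfl hr) hy
  · exact ((hasDerivWithinAt_integral_Icc hT.le (continuousOn_slice_snd hf.1 hx) ht).const_add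
      (primitiveAtTop g (x, 0))).congr
        (fun r hr => primitiveAtTop_eq_add_integral hT hg hf h hx hr)
        (primitiveAtTop_eq_add_integral hT hg hf h hx ht)

lemma stripDx_primitiveAtTop : EqOn (stripDx T (primitiveAtTop g)) g (halfStrip T) :=
  fun p hp => by
  rw [stripDx, dirDerivWithin, (hasFDerivWithinAt_primitiveAtTop hT hg hf h hp).fderivWithin
    (uniqueDiffOn_halfStrip hT p hp)]
  simp

lemma stripDt_primitiveAtTop : EqOn (stripDt T (primitiveAtTop g)) f (halfStrip T) :=
  fun p hp => by
  rw [stripDt, dirDerivWithin, (hasFDerivWithinAt_primitiveAtTop hT hg hf h hp).fderivWithin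
    (uniqueDiffOn_halfStrip hT p hp)]
  simp

lemma stripSchwartz_primitiveAtTop : StripSchwartz T (primitiveAtTop g) := by
  refine ⟨contDiffOn_of_hasFDerivWithinAt (uniqueDiffOn_halfStrip hT) hg.1 hf.1
    fun p hp => hasFDerivWithinAt_primitiveAtTop hT hg hf h hp, fun n => ?_⟩
  cases n with
  | zero =>
    intro N
    obtain ⟨C, hC⟩ := hg.rapidDecay (N + 2)
    refine ⟨C * Real.pi, fun x hx t ht => ?_⟩
    rw [Function.iterate_zero, id, primitiveAtTop, abs_neg]
    exact decay_integral_Ioi (f := fun y => g (y, t)) (fun y hy => hC y hy t ht) hx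
  | succ n =>
    rw [Function.iterate_succ_apply]
    exact (hg.2 n).congr
      (iterate_dirDerivWithin_congr (stripDx_primitiveAtTop hT hg hf h) _ n)

end Strip

end Auxiliary

/-- a Schwartz class solution u of the Boussinesq equation gives a
Schwartz class solution (u,v) of the Boussinesq system, with
v(x,t) = ∫_{+∞}^x u_t(x′,t)dx′, v₀(x) = ∫_{+∞}^x u₁(x′)dx′, and
ṽ₀(t) = ∫_{+∞}^0 u₁ + ∫_0^t (ũ₁ + 2ũ₀ũ₁ + ũ₃). -/
theorem statement1 (T : ℝ) (hT : 0 < T) (u : ℝ → ℝ → ℝ)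
    (u0 u1 tu0 tu1 tu2 tu3 : ℝ → ℝ)
    (hu0 : SchwartzHalfW u0) (hu1 : SchwartzHalfW u1)
    (htu0 : SmoothOnIcc T tu0) (htu1 : SmoothOnIcc T tu1)
    (htu2 : SmoothOnIcc T tu2) (htu3 : SmoothOnIcc T tu3)
    (hsol : IsSolEq T u u0 u1 tu0 tu1 tu2 tu3) :
    SchwartzHalfW (fun x => -∫ x' in Ioi x, u1 x') ∧
    SmoothOnIcc T (fun t => -(∫ x' in Ioi (0:ℝ), u1 x')
      + ∫ t' in (0:ℝ)..t, (tu1 t' + 2 * tu0 t' * tu1 t' + tu3 t')) ∧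
    IsSolSystem T u (fun x t => -∫ x' in Ioi x, dt1 T u x' t) u0
      (fun x => -∫ x' in Ioi x, u1 x') tu0 tu1 tu2
      (fun t => -(∫ x' in Ioi (0:ℝ), u1 x')
        + ∫ t' in (0:ℝ)..t, (tu1 t' + 2 * tu0 t' * tu1 t' + tu3 t')) := by
  obtain ⟨hsm, hpde, hinit, hbdry, hdec⟩ := hsol
  have hU := uniqueDiffOn_halfStrip hT
  have h0T : (0 : ℝ) ∈ Icc 0 T := ⟨le_rfl, hT.le⟩
  set U : ℝ × ℝ → ℝ := fun p => u p.1 p.2 with hUdef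
  have hux : ∀ n : ℕ, ∀ x ∈ Ici (0 : ℝ), ∀ t ∈ Icc 0 T, dxn n u t x = (stripDx T)^[n] U (x, t) :=
    fun n x hx t ht => dxn_eq_iterate_stripDx hT hsm (fun _ _ => rfl) hx ht n
  have hut : ∀ x ∈ Ici (0 : ℝ), ∀ t ∈ Icc 0 T, dt1 T u x t = stripDt T U (x, t) :=
    fun x hx t ht => dt1_eq_stripDt hT hsm (fun _ _ => rfl) hx ht
  have hUS : StripSchwartz T U := by
    refine ⟨hsm, fun n N => ?_⟩
    obtain ⟨C, hC⟩ := hdec (n + N + 1) (by omega)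
    refine ⟨C, fun x hx t ht => le_trans ?_ (hC x hx t ht)⟩
    rw [← hux n x hx t ht]
    refine le_trans ?_ (Finset.single_le_sum
      (f := fun i => (1 + x) ^ (n + N + 1) * |dxn i u t x|) (fun i _ => by positivity)
      (Finset.mem_range.2 (by omega : n < n + N + 1 + 1)))
    have : (1 : ℝ) ≤ 1 + x := by linarith
    gcongr
    omega
  have hUU : StripSchwartz T (U * U) := hUS.mul hT hUS
  have husq : ∀ n : ℕ, ∀ x ∈ Ici (0 : ℝ), ∀ t ∈ Icc 0 T,
      dxn n (fun y s => u y s ^ 2) t x = (stripDx T)^[n] (U * U) (x, t) :=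
    fun n x hx t ht => dxn_eq_iterate_stripDx hT hUU.1 (fun _ _ => sq _) hx ht n
  -- The flux in the conservation law `∂ₜ(∂ₜu) = ∂ₓF`.
  set F : ℝ × ℝ → ℝ := stripDx T U + stripDx T (U * U) + (stripDx T)^[3] U with hF
  have hFS : StripSchwartz T F :=
    ((hUS.stripDx hT).add hT (hUU.stripDx hT)).add hT (hUS.iterate_stripDx hT 3)
  set G : ℝ × ℝ → ℝ := stripDt T U with hG
  have hGsm : ContDiffOn ℝ (⊤ : ℕ∞) G (halfStrip T) := contDiffOn_dirDerivWithin hU hsm _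
  have hGF : EqOn (stripDt T G) (stripDx T F) (halfStrip T) := by
    rintro ⟨x, t⟩ ⟨hx, ht⟩
    have h1 := dirDerivWithin_add hU ((hUS.stripDx hT).add hT (hUU.stripDx hT)).1
      (hUS.iterate_stripDx hT 3).1 (1, 0) ⟨hx, ht⟩
    have h2 := dirDerivWithin_add hU (hUS.stripDx hT).1 (hUU.stripDx hT).1 (1, 0) ⟨hx, ht⟩
    have h3 := hpde x hx t ht
    rw [hux 2 x hx t ht, husq 2 x hx t ht, hux 4 x hx t ht] at h3
    have h4 := iteratedDerivWithin_snd (uniqueDiffOn_Ici 0) (uniqueDiffOn_Icc hT) hsm hx ht 2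
    rw [Pi.add_apply] at h1 h2
    rw [hF, stripDx, h1, h2]
    exact h4.symm.trans h3
  have hGS : StripSchwartz T G := by
    refine StripSchwartz.of_stripDt hT hGsm (fun n N => ?_) ((hFS.stripDx hT).congr hGF)
    refine (hu1.2 n N).imp fun C hC x hx => ?_
    rw [← iteratedDerivWithin_fst (uniqueDiffOn_Ici 0) (uniqueDiffOn_Icc hT) hGsm hx h0T]
    have e : EqOn (fun y => G (y, 0)) u1 (Ici 0) := fun y hy => by
      rw [← (hinit y hy).2, hut y hy 0 h0T]
    rw [iteratedDerivWithin_congr e hx]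
    exact hC x hx
  have hVS := stripSchwartz_primitiveAtTop hT hGS hFS hGF
  have hv : EqOn (fun p : ℝ × ℝ => -∫ x' in Ioi p.1, dt1 T u x' p.2) (primitiveAtTop G)
      (halfStrip T) := by
    rintro ⟨x, t⟩ ⟨hx, ht⟩
    simp only [primitiveAtTop]
    congr 1
    exact setIntegral_congr_fun measurableSet_Ioi
      fun y hy => hut y (mem_Ici.2 (le_trans hx (le_of_lt hy))) t ht
  have hv0 : ∀ x ∈ Ici (0 : ℝ), -∫ x' in Ioi x, u1 x' = primitiveAtTop G (x, 0) := by
    intro x hx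
    rw [← hv (mk_mem_prod hx h0T)]
    simp only
    congr 1
    exact setIntegral_congr_fun measurableSet_Ioi
      fun y hy => ((hinit y (mem_Ici.2 (le_trans hx (le_of_lt hy)))).2).symm
  have hvb : ∀ t ∈ Icc 0 T, -(∫ x' in Ioi (0 : ℝ), u1 x')
      + ∫ t' in (0 : ℝ)..t, (tu1 t' + 2 * tu0 t' * tu1 t' + tu3 t') =
        primitiveAtTop G (0, t) := by
    intro t ht
    rw [primitiveAtTop_eq_add_integral hT hGS hFS hGF le_rfl ht, hv0 0 self_mem_Ici]
    congr 1
    refine intervalIntegral.integral_congr fun r hr => ?_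
    rw [uIcc_of_le ht.1] at hr
    have hr' : r ∈ Icc 0 T := ⟨hr.1, hr.2.trans ht.2⟩
    obtain ⟨e0, e1, -, e3⟩ := hbdry r hr'
    have h1 := dirDerivWithin_mul hU hsm hsm (1, 0) (mk_mem_prod self_mem_Ici hr')
    rw [hux 1 0 self_mem_Ici r hr'] at e1
    rw [hux 3 0 self_mem_Ici r hr'] at e3
    simp only [hF, Pi.add_apply, stripDx, h1, Pi.mul_apply]
    simp only [Function.iterate_one, stripDx] at e1 e3
    rw [e1, e3, show U (0, r) = tu0 r from e0]
    ring
  have hvx : ∀ n : ℕ, ∀ x ∈ Ici (0 : ℝ), ∀ t ∈ Icc 0 T,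
      dxn n (fun x t => -∫ x' in Ioi x, dt1 T u x' t) t x =
        (stripDx T)^[n] (primitiveAtTop G) (x, t) :=
    fun n x hx t ht => dxn_eq_iterate_stripDx hT hVS.1 hv hx ht n
  refine ⟨(hVS.schwartzHalfW hT h0T).congr hv0, ?_, hsm, hVS.1.congr hv, ?_, ?_, ?_, ?_⟩
  · refine ContDiffOn.congr ?_ hvb
    exact hVS.1.comp (f := fun t => ((0 : ℝ), t)) (by fun_prop)
      fun _ ht => mk_mem_prod self_mem_Ici ht
  · intro x hx t ht
    rw [dt1_eq_stripDt hT hVS.1 hv hx ht, hux 1 x hx t ht, husq 1 x hx t ht, hux 3 x hx t ht,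
      hut x hx t ht, hvx 1 x hx t ht]
    exact ⟨stripDt_primitiveAtTop hT hGS hFS hGF ⟨hx, ht⟩,
      (stripDx_primitiveAtTop hT hGS hFS hGF ⟨hx, ht⟩).symm⟩
  · exact fun x hx => ⟨(hinit x hx).1, (hv (mk_mem_prod hx h0T)).trans (hv0 x hx).symm⟩
  · intro t ht
    obtain ⟨e0, e1, e2, -⟩ := hbdry t ht
    exact ⟨e0, e1, e2, (hv (mk_mem_prod self_mem_Ici ht)).trans (hvb t ht).symm⟩
  · intro N _
    choose A hA using fun i => hUS.2 i N
    choose B hB using fun i => hVS.2 i N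
    refine ⟨∑ i ∈ Finset.range (N + 1), (A i + B i), fun x hx t ht =>
      Finset.sum_le_sum fun i _ => ?_⟩
    rw [hux i x hx t ht, hvx i x hx t ht, mul_add]
    exact add_le_add (hA i x hx t ht) (hB i x hx t ht)
end
end

section
/- For every k ∈ ℂ∖{0}, the point 1/conj(k) satisfies the four inequalities Re l₁(1/conj(k)) < Re l₃(1/conj(k)), Re l₂(1/conj(k)) < Re l₃(1/conj(k)), Re z₃(1/conj(k)) < Re z₁(1/conj(k)), Re z₃(1/conj(k)) < Re z₂(1/conj(k)) if and only if k satisfies the four inequalities Re l₃(k) < Re l₁(k), Re l₃(k) < Re l₂(k), Re z₁(k) < Re z₃(k), Re z₂(k) < Re z₃(k). In other words, 𝒮₁* = {Re l₃ < Re l₁} ∩ {Re l₃ < Re l₂} ∩ {Re z₁ < Re z₃} ∩ {Re z₂ < Re z₃}, where 𝒮₁* := {z ∈ ℂ∖{0} : 1/conj(z) ∈ 𝒮₁}. -/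
noncomputable section

open MeasureTheory Matrix Set

/-- ω = e^{2πi/3}. -/
def ω : ℂ := Complex.exp (2 * Real.pi * Complex.I / 3)

/-- l_j(k) = i(ω^j k + (ω^j k)⁻¹)/(2√3), with `j : Fin 3` encoding the index j+1 ∈ {1,2,3}. -/
def lf (j : Fin 3) (k : ℂ) : ℂ :=
  Complex.I * (ω ^ (j.val + 1) * k + (ω ^ (j.val + 1) * k)⁻¹) / (2 * (Real.sqrt 3 : ℂ))

/-- z_j(k) = i((ω^j k)² + (ω^j k)^{-2})/(4√3). -/
def zf (j : Fin 3) (k : ℂ) : ℂ :=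
  Complex.I * ((ω ^ (j.val + 1) * k) ^ 2 + ((ω ^ (j.val + 1) * k) ^ 2)⁻¹) / (4 * (Real.sqrt 3 : ℂ))

theorem conj_omega_mul (n : ℕ) (k : ℂ) :
    ω ^ n * ((starRingEnd ℂ) k)⁻¹ = ((starRingEnd ℂ) (ω ^ n * k))⁻¹ := by
  have hω : (starRingEnd ℂ) ω = ω⁻¹ := by
    rw [ω, ← Complex.exp_conj, ← Complex.exp_neg]
    simp only [map_div₀, map_mul, Complex.conj_I, Complex.conj_ofReal, map_ofNat, mul_neg, neg_div]
  simp [hω, mul_comm]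

theorem lf_inv_conj (j : Fin 3) (k : ℂ) :
    lf j ((starRingEnd ℂ) k)⁻¹ = -(starRingEnd ℂ) (lf j k) := by
  simp only [lf, conj_omega_mul, inv_inv]
  generalize ω ^ (j.val + 1) * k = u
  simp only [map_div₀, map_mul, map_add, map_inv₀, Complex.conj_I, Complex.conj_ofReal,
    map_ofNat]
  ring

theorem zf_inv_conj (j : Fin 3) (k : ℂ) :
    zf j ((starRingEnd ℂ) k)⁻¹ = -(starRingEnd ℂ) (zf j k) := by
  simp only [zf, conj_omega_mul]
  generalize ω ^ (j.val + 1) * k = u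
  simp only [map_div₀, map_mul, map_add, map_inv₀, map_pow, Complex.conj_I, Complex.conj_ofReal,
    map_ofNat, inv_pow, inv_inv]
  ring

/-- 𝒮₁* = {Re l₃ < Re l₁} ∩ {Re l₃ < Re l₂} ∩ {Re z₁ < Re z₃} ∩ {Re z₂ < Re z₃}. -/
theorem statement5 (k : ℂ) (hk : k ≠ 0) :
    ((lf 0 ((starRingEnd ℂ) k)⁻¹).re < (lf 2 ((starRingEnd ℂ) k)⁻¹).re ∧
     (lf 1 ((starRingEnd ℂ) k)⁻¹).re < (lf 2 ((starRingEnd ℂ) k)⁻¹).re ∧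
     (zf 2 ((starRingEnd ℂ) k)⁻¹).re < (zf 0 ((starRingEnd ℂ) k)⁻¹).re ∧
     (zf 2 ((starRingEnd ℂ) k)⁻¹).re < (zf 1 ((starRingEnd ℂ) k)⁻¹).re) ↔
    ((lf 2 k).re < (lf 0 k).re ∧ (lf 2 k).re < (lf 1 k).re ∧
     (zf 0 k).re < (zf 2 k).re ∧ (zf 1 k).re < (zf 2 k).re) := by
  simp only [lf_inv_conj, zf_inv_conj, Complex.neg_re, Complex.conj_re, neg_lt_neg_iff]
end
end

section
/- For every k ∈ ℂ∖{0}, the point 1/conj(k) satisfies the four inequalities Re l₁(1/conj(k)) < Re l₃(1/conj(k)), Re l₂(1/conj(k)) < Re l₃(1/conj(k)), Re z₁(1/conj(k)) < Re z₃(1/conj(k)), Re z₂(1/conj(k)) < Re z₃(1/conj(k)) if and only if k satisfies Re l₃(k) < Re l₁(k), Re l₃(k) < Re l₂(k), Re z₃(k) < Re z₁(k), Re z₃(k) < Re z₂(k). In other words, 𝒮₂* = {Re l₃ < Re l₁} ∩ {Re l₃ < Re l₂} ∩ {Re z₃ < Re z₁} ∩ {Re z₃ < Re z₂}, where 𝒮₂*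 := {z ∈ ℂ∖{0} : 1/conj(z) ∈ 𝒮₂}. -/
noncomputable section

open MeasureTheory Matrix Set

theorem conj_ω : (starRingEnd ℂ) ω = ω⁻¹ := by
  rw [ω, ← Complex.exp_conj, ← Complex.exp_neg]
  congr 1
  simp [neg_div, map_ofNat]

/-- The inversion `k ↦ 1 / conj k` commutes with multiplication by powers of `ω`. -/
theorem ω_pow_mul_inv_conj (n : ℕ) (k : ℂ) :
    ω ^ n * ((starRingEnd ℂ) k)⁻¹ = (starRingEnd ℂ) (ω ^ n * k)⁻¹ := by
  simp [conj_ω, mul_comm]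

/-- 𝒮₂* = {Re l₃ < Re l₁} ∩ {Re l₃ < Re l₂} ∩ {Re z₃ < Re z₁} ∩ {Re z₃ < Re z₂}. -/
theorem statement6 (k : ℂ) (hk : k ≠ 0) :
    ((lf 0 ((starRingEnd ℂ) k)⁻¹).re < (lf 2 ((starRingEnd ℂ) k)⁻¹).re ∧
     (lf 1 ((starRingEnd ℂ) k)⁻¹).re < (lf 2 ((starRingEnd ℂ) k)⁻¹).re ∧
     (zf 0 ((starRingEnd ℂ) k)⁻¹).re < (zf 2 ((starRingEnd ℂ) k)⁻¹).re ∧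
     (zf 1 ((starRingEnd ℂ) k)⁻¹).re < (zf 2 ((starRingEnd ℂ) k)⁻¹).re) ↔
    ((lf 2 k).re < (lf 0 k).re ∧ (lf 2 k).re < (lf 1 k).re ∧
     (zf 2 k).re < (zf 0 k).re ∧ (zf 2 k).re < (zf 1 k).re) := by
  simp only [lf_inv_conj, zf_inv_conj, Complex.neg_re, Complex.conj_re, neg_lt_neg_iff]
end
end

section
/- Let T > 0 and let ũ₀, ũ₁, ũ₂, ṽ₀ ∈ C^∞([0,T]) be real-valued. Let μ₁(t,k) be, for each k ∈ ℂ∖Q̂, the unique continuous solution on [0,T] of the Volterra equation μ₁(t,k) = I − ∫_t^T e^{(t−t′)𝒵(k)} 𝖵(t′,k) μ₁(t′,k) e^{−(t−t′)𝒵(k)} dt′. Then for all t ∈ [0,T] and all k ∈ ℂ∖Q̂ one has the symmetries μ₁(t,k) = 𝒜 μ₁(t, ωk) 𝒜^{-1} and μ₁(t,k) = ℬ μ₁(t, 1/k) ℬ. -/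
noncomputable section

open MeasureTheory Matrix Set

/-- P(k): rows (1,1,1), (l₁,l₂,l₃), (l₁²,l₂²,l₃²). -/
def Pmat (k : ℂ) : Matrix (Fin 3) (Fin 3) ℂ := Matrix.of fun i j => lf j k ^ (i.val)

/-- Q: the sixth roots of unity κ_j = e^{iπ(j-1)/3}. -/
def Qset : Set ℂ := {k : ℂ | k ^ 6 = 1}

/-- Q̂ = Q ∪ {0}. -/
def Qhat : Set ℂ := insert 0 Qset

/-- The lower-triangular matrix N(t) built from the boundary values. -/
def Nmat (tu0 tu1 tu2 tv0 : ℝ → ℝ) (t : ℝ) : Matrix (Fin 3) (Fin 3) ℂ :=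
  !![-Complex.I * (tu0 t : ℂ) / (Real.sqrt 3 : ℂ), 0, 0;
     -Complex.I * (tu1 t : ℂ) / (4 * (Real.sqrt 3 : ℂ)) - (tv0 t : ℂ) / 4,
       Complex.I * (tu0 t : ℂ) / (2 * (Real.sqrt 3 : ℂ)), 0;
     -Complex.I * (tu2 t : ℂ) / (4 * (Real.sqrt 3 : ℂ)) - ((deriv tu0 t : ℝ) : ℂ) / 4,
       Complex.I * (tu1 t : ℂ) / (4 * (Real.sqrt 3 : ℂ)) - (tv0 t : ℂ) / 4,
       Complex.I * (tu0 t : ℂ) / (2 * (Real.sqrt 3 : ℂ))]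

/-- 𝖵(t,k) = P(k)⁻¹ N(t) P(k). -/
def Vmat (tu0 tu1 tu2 tv0 : ℝ → ℝ) (t : ℝ) (k : ℂ) : Matrix (Fin 3) (Fin 3) ℂ :=
  (Pmat k)⁻¹ * Nmat tu0 tu1 tu2 tv0 t * Pmat k

/-- μ is a continuous solution on [0,T] of the t-Volterra equation
μ(t) = I − ∫_t^T e^{(t−t′)Ẑ(k)}(𝖵 μ)(t′) dt′, written entrywise:
(e^{sẐ}A)_{ij} = e^{s(z_i−z_j)}A_{ij}. -/
def SolvesT (T : ℝ) (tu0 tu1 tu2 tv0 : ℝ → ℝ) (k : ℂ)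
    (μ : ℝ → Matrix (Fin 3) (Fin 3) ℂ) : Prop :=
  (∀ i j : Fin 3, ContinuousOn (fun t => μ t i j) (Set.Icc 0 T)) ∧
  (∀ t ∈ Set.Icc (0:ℝ) T, ∀ i j : Fin 3,
    μ t i j = (if i = j then 1 else 0) -
      ∫ t' in t..T, Complex.exp (((t : ℂ) - (t' : ℂ)) * (zf i k - zf j k)) *
        ((Vmat tu0 tu1 tu2 tv0 t' k) * μ t') i j)

/-- 𝒜 = rows (0,0,1),(1,0,0),(0,1,0). -/
def Amat : Matrix (Fin 3) (Fin 3) ℂ := !![0,0,1; 1,0,0; 0,1,0]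

/-- ℬ = rows (0,1,0),(1,0,0),(0,0,1). -/
def Bmat : Matrix (Fin 3) (Fin 3) ℂ := !![0,1,0; 1,0,0; 0,0,1]

lemma omega_cube : ω ^ 3 = 1 := by
  rw [ω, ← Complex.exp_nat_mul, ← Complex.exp_two_pi_mul_I]
  congr 1
  push_cast
  ring

lemma omega_ne_zero : ω ≠ 0 := Complex.exp_ne_zero _

lemma omega_inv : ω⁻¹ = ω ^ 2 := by
  refine inv_eq_of_mul_eq_one_right ?_
  rw [← pow_succ', omega_cube]

lemma omega_mul_notMem_Qhat {k : ℂ} (hk : k ∉ Qhat) : ω * k ∉ Qhat := by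
  have h6 : ω ^ 6 = 1 := by rw [show ω ^ 6 = (ω ^ 3) ^ 2 by ring, omega_cube, one_pow]
  simpa [Qhat, Qset, mul_pow, h6, omega_ne_zero] using hk

lemma inv_notMem_Qhat {k : ℂ} (hk : k ∉ Qhat) : k⁻¹ ∉ Qhat := by
  simpa [Qhat, Qset] using hk

/-- A nonnegative function bounded by a multiple of its integral up to `T` vanishes. -/
lemma eq_zero_of_le_mul_integral {T C : ℝ} {u : ℝ → ℝ} (hu : ContinuousOn u (Icc 0 T))
    (hu0 : ∀ t ∈ Icc 0 T, 0 ≤ u t) (hC : 0 ≤ C)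
    (hle : ∀ t ∈ Icc 0 T, u t ≤ C * ∫ s in t..T, u s) :
    ∀ t ∈ Icc 0 T, u t = 0 := by
  intro t ht
  have hT : 0 ≤ T := ht.1.trans ht.2
  set w : ℝ → ℝ := IccExtend hT ((Icc 0 T).domRestrict u) with hw
  have hwc : Continuous w := (continuousOn_iff_continuous_domRestrict.1 hu).Icc_extend'
  have hwu : ∀ s ∈ Icc 0 T, w s = u s := fun s hs => by
    simp [hw, IccExtend_of_mem hT _ hs]
  have hint : ∀ s ∈ Icc 0 T, ∫ r in s..T, w r = ∫ r in s..T, u r := fun s hs => by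
    refine intervalIntegral.integral_congr fun r hr => hwu r ?_
    rw [uIcc_of_le hs.2] at hr
    exact ⟨hs.1.trans hr.1, hr.2⟩
  set F : ℝ → ℝ := fun s => Real.exp (C * s) * ∫ r in s..T, w r with hF
  have hderiv : ∀ s, HasDerivAt F
      (Real.exp (C * s) * (C * (∫ r in s..T, w r) - w s)) s := fun s => by
    have h1 : HasDerivAt (fun s => ∫ r in s..T, w r) (-w s) s :=
      intervalIntegral.integral_hasDerivAt_left (hwc.intervalIntegrable _ _)
        (hwc.stronglyMeasurableAtFilter _ _) hwc.continuousAt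
    have h2 : HasDerivAt (fun s => Real.exp (C * s)) (Real.exp (C * s) * C) s := by
      simpa using ((hasDerivAt_id s).const_mul C).exp
    refine (h2.mul h1).congr_deriv ?_
    ring
  have hmono : MonotoneOn F (Icc 0 T) := by
    refine monotoneOn_of_deriv_nonneg (convex_Icc 0 T)
      (fun s _ => (hderiv s).continuousAt.continuousWithinAt)
      (fun s _ => (hderiv s).differentiableAt.differentiableWithinAt) fun s hs => ?_
    have hs' := interior_subset hs
    rw [(hderiv s).deriv, hint s hs', hwu s hs']
    exact mul_nonneg (Real.exp_pos _).le (sub_nonneg.2 (hle s hs'))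
  have hFt : F t ≤ 0 := by
    simpa [hF] using hmono ht ⟨hT, le_rfl⟩ ht.2
  have hI : ∫ r in t..T, u r ≤ 0 := by
    rw [← hint t ht]
    exact nonpos_of_mul_nonpos_right hFt (Real.exp_pos _)
  exact le_antisymm ((hle t ht).trans (mul_nonpos_of_nonneg_of_nonpos hC hI)) (hu0 t ht)

lemma continuous_Vmat_apply {tu0 tu1 tu2 tv0 : ℝ → ℝ} (h0 : Continuous tu0)
    (h0' : Continuous (deriv tu0)) (h1 : Continuous tu1) (h2 : Continuous tu2)
    (h3 : Continuous tv0) (k : ℂ) (i j : Fin 3) :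
    Continuous fun t => Vmat tu0 tu1 tu2 tv0 t k i j := by
  have hN : Continuous fun t => Nmat tu0 tu1 tu2 tv0 t := by
    refine continuous_matrix fun a b => ?_
    fin_cases a <;> fin_cases b <;> simp [Nmat] <;> fun_prop
  exact ((continuous_const.matrix_mul hN).matrix_mul continuous_const).matrix_elem i j

/-- Uniqueness of continuous solutions of the Volterra equation. -/
lemma SolvesT.unique {T : ℝ} {tu0 tu1 tu2 tv0 : ℝ → ℝ} {k : ℂ}
    {μ ν : ℝ → Matrix (Fin 3) (Fin 3) ℂ}
    (hV : ∀ i j, Continuous fun t => Vmat tu0 tu1 tu2 tv0 t k i j)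
    (hμ : SolvesT T tu0 tu1 tu2 tv0 k μ) (hν : SolvesT T tu0 tu1 tu2 tv0 k ν) :
    ∀ t ∈ Icc 0 T, μ t = ν t := by
  set V := fun t => Vmat tu0 tu1 tu2 tv0 t k with hVdef
  set u : ℝ → ℝ := fun t => ∑ i, ∑ j, ‖μ t i j - ν t i j‖ with hu
  have huc : ContinuousOn u (Icc 0 T) :=
    continuousOn_finsetSum _ fun i _ => continuousOn_finsetSum _ fun j _ =>
      ((hμ.1 i j).sub (hν.1 i j)).norm
  have hentry : ∀ t i j, ‖μ t i j - ν t i j‖ ≤ u t := fun t i j =>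
    (Finset.single_le_sum (f := fun j => ‖μ t i j - ν t i j‖)
      (fun _ _ => norm_nonneg _) (Finset.mem_univ j)).trans
    (Finset.single_le_sum (f := fun i => ∑ j, ‖μ t i j - ν t i j‖)
      (fun _ _ => Finset.sum_nonneg fun _ _ => norm_nonneg _) (Finset.mem_univ i))
  have hu0 : ∀ t, 0 ≤ u t := fun t =>
    Finset.sum_nonneg fun _ _ => Finset.sum_nonneg fun _ _ => norm_nonneg _
  set K : Fin 3 → Fin 3 → Fin 3 → ℝ × ℝ → ℂ := fun i j l p =>
    Complex.exp (((p.1 : ℂ) - (p.2 : ℂ)) * (zf i k - zf j k)) * V p.2 i l with hK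
  have hKc : ∀ i j l, Continuous (K i j l) := fun i j l => by
    have := (hV i l).comp (continuous_snd (X := ℝ) (Y := ℝ))
    exact (by fun_prop : Continuous fun p : ℝ × ℝ =>
      Complex.exp (((p.1 : ℂ) - (p.2 : ℂ)) * (zf i k - zf j k))).mul this
  have hbound : ∀ i j l, ∃ C, ∀ p ∈ Icc (0 : ℝ) T ×ˢ Icc (0 : ℝ) T, ‖K i j l p‖ ≤ C :=
    fun i j l => (isCompact_Icc.prod isCompact_Icc).exists_bound_of_continuousOn
      (hKc i j l).continuousOn
  choose C hC using hbound
  have hmain : ∀ t ∈ Icc 0 T, ∀ i j,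
      ‖μ t i j - ν t i j‖ ≤ (∑ l, |C i j l|) * ∫ s in t..T, u s := by
    intro t ht i j
    have hsub : Icc t T ⊆ Icc 0 T := Icc_subset_Icc_left ht.1
    have hint : ∀ ρ : ℝ → Matrix (Fin 3) (Fin 3) ℂ,
        (∀ i j, ContinuousOn (fun t => ρ t i j) (Icc 0 T)) →
        IntervalIntegrable (fun t' => Complex.exp (((t : ℂ) - (t' : ℂ)) * (zf i k - zf j k)) *
          (V t' * ρ t') i j) volume t T := by
      intro ρ hρ
      refine ContinuousOn.intervalIntegrable ?_
      rw [uIcc_of_le ht.2]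
      simp only [Matrix.mul_apply]
      refine ContinuousOn.mul (by fun_prop) (continuousOn_finsetSum _ fun l _ => ?_)
      exact (hV i l).continuousOn.mul ((hρ l j).mono hsub)
    have heq : μ t i j - ν t i j =
        -∫ s in t..T, ∑ l, K i j l (t, s) * (μ s l j - ν s l j) := by
      rw [hμ.2 t ht i j, hν.2 t ht i j, sub_sub_sub_cancel_left,
        ← intervalIntegral.integral_sub (hint ν hν.1) (hint μ hμ.1),
        ← intervalIntegral.integral_neg]
      refine intervalIntegral.integral_congr fun s _ => ?_
      simp only [hK, Matrix.mul_apply, Finset.mul_sum, ← Finset.sum_sub_distrib,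
        ← Finset.sum_neg_distrib]
      exact Finset.sum_congr rfl fun l _ => by simp only [hVdef]; ring
    rw [heq, norm_neg, ← intervalIntegral.integral_const_mul]
    refine intervalIntegral.norm_integral_le_of_norm_le ht.2 (ae_of_all _ fun s hs => ?_) ?_
    · rw [Finset.sum_mul]
      refine norm_sum_le_of_le _ fun l _ => ?_
      rw [norm_mul]
      exact mul_le_mul ((hC i j l (t, s) ⟨ht, hsub ⟨hs.1.le, hs.2⟩⟩).trans (le_abs_self _))
        (hentry s l j) (norm_nonneg _) (abs_nonneg _)
    · refine ContinuousOn.intervalIntegrable ?_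
      rw [uIcc_of_le ht.2]
      exact continuousOn_const.mul (huc.mono hsub)
  have hzero := eq_zero_of_le_mul_integral (C := ∑ i, ∑ j, ∑ l, |C i j l|) huc
    (fun t _ => hu0 t) (by positivity) fun t ht => by
      simp only [Finset.sum_mul _ _ (∫ s in t..T, u s)]
      refine Finset.sum_le_sum fun i _ => Finset.sum_le_sum fun j _ => ?_
      simpa only [Finset.sum_mul] using hmain t ht i j
  intro t ht
  ext i j
  have := (hentry t i j).trans (hzero t ht).le
  exact sub_eq_zero.1 (norm_le_zero_iff.1 this)

lemma Vmat_eq_submatrix {tu0 tu1 tu2 tv0 : ℝ → ℝ} {k k' : ℂ} (σ : Equiv.Perm (Fin 3))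
    (hl : ∀ j, lf j k = lf (σ j) k') (t : ℝ) :
    Vmat tu0 tu1 tu2 tv0 t k = (Vmat tu0 tu1 tu2 tv0 t k').submatrix σ σ := by
  have hP : Pmat k = (Pmat k').submatrix (Equiv.refl _) σ := by
    ext i j
    simp [Pmat, hl]
  simp only [Vmat]
  rw [hP, Matrix.inv_submatrix_equiv]
  ext i j
  simp [Matrix.mul_apply]

/-- Relabelling the columns of `Pmat` conjugates solutions by a permutation. -/
lemma SolvesT.submatrix {T : ℝ} {tu0 tu1 tu2 tv0 : ℝ → ℝ} {k k' : ℂ}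
    {μ : ℝ → Matrix (Fin 3) (Fin 3) ℂ} (σ : Equiv.Perm (Fin 3))
    (hl : ∀ j, lf j k = lf (σ j) k') (hz : ∀ j, zf j k = zf (σ j) k')
    (hμ : SolvesT T tu0 tu1 tu2 tv0 k' μ) :
    SolvesT T tu0 tu1 tu2 tv0 k fun t => (μ t).submatrix σ σ := by
  refine ⟨fun i j => hμ.1 (σ i) (σ j), fun t ht i j => ?_⟩
  simp only [Vmat_eq_submatrix σ hl, Matrix.submatrix_mul_equiv, hz]
  simpa using hμ.2 t ht (σ i) (σ j)

lemma Amat_conj (M : Matrix (Fin 3) (Fin 3) ℂ) :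
    Amat * M * Amat⁻¹ = M.submatrix (finRotate 3).symm (finRotate 3).symm := by
  have hinv : Amat⁻¹ = !![0,1,0; 0,0,1; 1,0,0] := by
    refine Matrix.inv_eq_right_inv ?_
    ext i j
    fin_cases i <;> fin_cases j <;> simp [Amat, Matrix.mul_apply, Fin.sum_univ_three]
  have e0 : (finRotate 3).symm 0 = 2 := by decide
  have e1 : (finRotate 3).symm 1 = 0 := by decide
  have e2 : (finRotate 3).symm 2 = 1 := by decide
  rw [hinv]
  ext i j
  fin_cases i <;> fin_cases j <;>
    simp [Amat, Matrix.mul_apply, Matrix.vecMul, dotProduct, Fin.sum_univ_three, e0, e1, e2]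

lemma Bmat_conj (M : Matrix (Fin 3) (Fin 3) ℂ) :
    Bmat * M * Bmat = M.submatrix (Equiv.swap 0 1) (Equiv.swap 0 1) := by
  have e2 : Equiv.swap (0 : Fin 3) 1 2 = 2 := by decide
  ext i j
  fin_cases i <;> fin_cases j <;>
    simp [Bmat, Matrix.mul_apply, Matrix.vecMul, dotProduct, Fin.sum_univ_three, e2]

lemma omega_pow_rotate (k : ℂ) (j : Fin 3) :
    ω ^ (((finRotate 3).symm j).val + 1) * (ω * k) = ω ^ (j.val + 1) * k := by
  have e0 : (finRotate 3).symm 0 = 2 := by decide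
  have e1 : (finRotate 3).symm 1 = 0 := by decide
  have e2 : (finRotate 3).symm 2 = 1 := by decide
  fin_cases j
  · simp only [Fin.zero_eta, e0]
    norm_num
    linear_combination ω * k * omega_cube
  · simp [e1]; ring
  · simp [e2]; ring

lemma omega_pow_swap (k : ℂ) (j : Fin 3) :
    ω ^ ((Equiv.swap (0 : Fin 3) 1 j).val + 1) * k⁻¹ = (ω ^ (j.val + 1) * k)⁻¹ := by
  have e2 : Equiv.swap (0 : Fin 3) 1 2 = 2 := by decide
  rw [mul_inv]
  congr 1
  fin_cases j
  · simp [omega_inv]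
  · simp [← omega_inv]
  · simp [e2, omega_cube]

/-- the symmetries μ₁(t,k) = 𝒜 μ₁(t,ωk) 𝒜⁻¹ = ℬ μ₁(t,1/k) ℬ. -/
theorem statement11 (T : ℝ) (hT : 0 < T) (tu0 tu1 tu2 tv0 : ℝ → ℝ)
    (h0 : ContDiff ℝ (⊤ : ℕ∞) tu0) (h1 : ContDiff ℝ (⊤ : ℕ∞) tu1)
    (h2 : ContDiff ℝ (⊤ : ℕ∞) tu2) (h3 : ContDiff ℝ (⊤ : ℕ∞) tv0)
    (μ : ℝ → ℂ → Matrix (Fin 3) (Fin 3) ℂ)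
    (hμ : ∀ k ∉ Qhat, SolvesT T tu0 tu1 tu2 tv0 k (fun t => μ t k)) :
    ∀ k ∉ Qhat, ∀ t ∈ Set.Icc (0:ℝ) T,
      μ t k = Amat * μ t (ω * k) * Amat⁻¹ ∧ μ t k = Bmat * μ t k⁻¹ * Bmat := by
  intro k hk t ht
  have hV := continuous_Vmat_apply h0.continuous
    (h0.continuous_deriv (by exact_mod_cast le_top)) h1.continuous h2.continuous h3.continuous k
  rw [Amat_conj, Bmat_conj]
  constructor
  · refine (hμ k hk).unique hV ((hμ _ (omega_mul_notMem_Qhat hk)).submatrix _ ?_ ?_) t ht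
    · intro j
      simp only [lf, omega_pow_rotate]
    · intro j
      simp only [zf, omega_pow_rotate]
  · refine (hμ k hk).unique hV ((hμ _ (inv_notMem_Qhat hk)).submatrix _ ?_ ?_) t ht
    · intro j
      rw [lf, lf, omega_pow_swap, inv_inv, add_comm (ω ^ _ * k)]
    · intro j
      rw [zf, zf, omega_pow_swap, inv_pow, inv_inv, add_comm ((ω ^ _ * k) ^ 2)]
end
end
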